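/- arXiv:1206.1897 — 2 statements merged into one kernel-verified Lean document; each statement's English description precedes it below -/
import Mathlib

section
/- Let k ≥ 4 be an even integer and let D be a k-quasi-transitive digraph with a unique initial strong component C. Then at least one of the following holds: (1) every vertex of C is a (k+1)-king of D; (2) there exist vertices u_1, u_2, u_3 in C such that u_1 is a (k+1)-king of D, u_2 is a (k+2)-king of D, u_2 → u_1, d(u_2,u_3) = k+2, u_3 is a 2-king of D, and every vertex at distance k+2 from u_2 is a 3-king of D. -/
variable {V : Type*}

/-- A directed path of length `n` from `u` to `v` in the digraph with arc relation `A`: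
a sequence of `n + 1` pairwise distinct vertices, consecutive ones joined by arcs. -/
def HasPathN (A : V → V → Prop) (u v : V) (n : ℕ) : Prop :=
  ∃ f : Fin (n + 1) → V, Function.Injective f ∧ f 0 = u ∧ f (Fin.last n) = v ∧
    ∀ i : Fin n, A (f i.castSucc) (f i.succ)

/-- The distance from `u` to `v`: the length of a shortest directed path from `u` to `v`,
`⊤` if there is no such path. -/
noncomputable def ddist (A : V → V → Prop) (u v : V) : ℕ∞ :=
  sInf {n : ℕ∞ | ∃ m : ℕ, n = (m : ℕ∞) ∧ HasPathN A u v m}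

/-- `D` is `k`-quasi-transitive if for every directed path `(v_0, …, v_k)` of length `k`,
either `(v_0, v_k)` or `(v_k, v_0)` is an arc. -/
def KQuasiTrans (A : V → V → Prop) (k : ℕ) : Prop :=
  ∀ u v : V, HasPathN A u v k → A u v ∨ A v u

/-- A vertex `v` is an `r`-king if every vertex is within distance `r` from `v`. -/
def IsRKing (A : V → V → Prop) (r : ℕ) (v : V) : Prop :=
  ∀ u : V, ddist A v u ≤ (r : ℕ∞)

/-- `u` reaches `v` by a directed path. -/
def Reaches (A : V → V → Prop) (u v : V) : Prop :=
  ∃ n : ℕ, HasPathN A u v n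

/-- A strong component: the set of all vertices mutually reachable with some vertex. -/
def IsStrongComponent (A : V → V → Prop) (S : Set V) : Prop :=
  ∃ v : V, S = {u | Reaches A u v ∧ Reaches A v u}

/-- An initial strong component: a strong component receiving no arcs from outside. -/
def IsInitialStrongComponent (A : V → V → Prop) (S : Set V) : Prop :=
  IsStrongComponent A S ∧ ∀ u v : V, u ∉ S → v ∈ S → ¬ A u v

/-- The out-degree of `v` in `D`. -/
noncomputable def outDeg (A : V → V → Prop) (v : V) : ℕ :=
  {u : V | A v u}.ncard

/-- The out-degree of `v` in the subdigraph of `D` induced by `C`. -/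
noncomputable def outDegIn (A : V → V → Prop) (C : Set V) (v : V) : ℕ :=
  {u ∈ C | A v u}.ncard

/-- The maximum out-degree of the subdigraph induced by `C`. -/
noncomputable def maxOutDegIn (A : V → V → Prop) (C : Set V) : ℕ :=
  sSup (outDegIn A C '' C)

theorem hasPathN_of_nat {A : V → V → Prop} (g : ℕ → V) (n : ℕ)
    (hinj : ∀ i ≤ n, ∀ j ≤ n, g i = g j → i = j) (harc : ∀ i < n, A (g i) (g (i + 1))) :
    HasPathN A (g 0) (g n) n := by
  refine ⟨fun i => g i, fun i j h => ?_, by simp, by simp, fun i => ?_⟩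
  · exact Fin.ext (hinj _ (by omega) _ (by omega) h)
  · simpa using harc i i.2

theorem HasPathN.exists_nat {A : V → V → Prop} {u v : V} {n : ℕ} (h : HasPathN A u v n) :
    ∃ g : ℕ → V, g 0 = u ∧ g n = v ∧ (∀ i ≤ n, ∀ j ≤ n, g i = g j → i = j) ∧
      ∀ i < n, A (g i) (g (i + 1)) := by
  obtain ⟨f, hinj, h0, hn, harc⟩ := h
  refine ⟨fun i => if hi : i < n + 1 then f ⟨i, hi⟩ else u, ?_, ?_, ?_, ?_⟩
  · simpa using h0
  · exact (dif_pos (Nat.lt_succ_self n)).trans hn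
  · intro i hi j hj hij
    simp only [Nat.lt_succ_of_le hi, Nat.lt_succ_of_le hj, dif_pos] at hij
    simpa using hinj hij
  · intro i hi
    have h1 : i < n + 1 := by omega
    have h2 : i + 1 < n + 1 := by omega
    simp only [h1, h2, dif_pos]
    exact harc ⟨i, hi⟩

theorem ddist_le_of_hasPathN {A : V → V → Prop} {u v : V} {m : ℕ} (h : HasPathN A u v m) :
    ddist A u v ≤ m :=
  sInf_le ⟨m, rfl, h⟩

theorem hasPathN_of_ddist_eq {A : V → V → Prop} {u v : V} {m : ℕ} (h : ddist A u v = m) :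
    HasPathN A u v m := by
  have hne : {n : ℕ∞ | ∃ m : ℕ, n = (m : ℕ∞) ∧ HasPathN A u v m}.Nonempty := by
    by_contra hcon
    rw [Set.not_nonempty_iff_eq_empty] at hcon
    rw [ddist, hcon, sInf_empty] at h
    exact ENat.natCast_ne_top m h.symm
  obtain ⟨m', hm', hp⟩ := csInf_mem hne
  have : (m : ℕ∞) = m' := h.symm.trans hm'
  rwa [Nat.cast_inj.mp this]

theorem ddist_self (A : V → V → Prop) (u : V) : ddist A u u = 0 := by
  have := ddist_le_of_hasPathN (hasPathN_of_nat (A := A) (fun _ => u) 0 (by omega) (by omega))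
  simpa using this

theorem ddist_le_add_one {A : V → V → Prop} {v w : V} (u : V) (h : A v w) :
    ddist A u w ≤ ddist A u v + 1 := by
  rcases eq_or_ne (ddist A u v) ⊤ with ht | ht
  · simp [ht]
  obtain ⟨m, hm⟩ := ENat.ne_top_iff_exists.mp ht
  obtain ⟨g, h0, hg, hinj, harc⟩ := (hasPathN_of_ddist_eq hm.symm).exists_nat
  rw [← hm]
  by_cases hw : ∃ i ≤ m, g i = w
  · obtain ⟨i, hi, rfl⟩ := hw
    have hp : HasPathN A (g 0) (g i) i :=
      hasPathN_of_nat g i (fun a ha b hb => hinj a (by omega) b (by omega))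
        fun a ha => harc a (by omega)
    rw [h0] at hp
    refine (ddist_le_of_hasPathN hp).trans ?_
    exact_mod_cast (by omega : i ≤ m + 1)
  · push Not at hw
    have hp := hasPathN_of_nat (A := A) (fun i => if i ≤ m then g i else w) (m + 1) (by
      intro i hi j hj hij
      by_cases him : i ≤ m <;> by_cases hjm : j ≤ m <;> simp only [him, hjm, if_true, if_false] at hij
      · exact hinj i him j hjm hij
      · exact absurd hij (hw i him)
      · exact absurd hij.symm (hw j hjm)
      · omega) (by
      intro i hi
      by_cases him : i + 1 ≤ m
      · simpa only [him, (by omega : i ≤ m), if_true] using harc i him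
      · obtain rfl : i = m := by omega
        simpa [hg] using h)
    rw [if_pos (Nat.zero_le m), h0, if_neg (Nat.not_succ_le_self m)] at hp
    exact_mod_cast ddist_le_of_hasPathN hp

/-- The first `m + 1` terms of `g` form a path starting at `u`, all of whose initial segments are
shortest paths. -/
structure IsGeodesic (A : V → V → Prop) (u : V) (m : ℕ) (g : ℕ → V) : Prop where
  zero : g 0 = u
  arc : ∀ i < m, A (g i) (g (i + 1))
  dist : ∀ i ≤ m, ddist A u (g i) = i

theorem ddist_walk_le {A : V → V → Prop} (u : V) {g : ℕ → V} {i n : ℕ}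
    (harc : ∀ j < n, A (g (i + j)) (g (i + j + 1))) :
    ddist A u (g (i + n)) ≤ ddist A u (g i) + n := by
  induction n with
  | zero => simp
  | succ n ih =>
    refine (ddist_le_add_one u (harc n (by omega))).trans ?_
    push_cast
    rw [← add_assoc]
    gcongr
    exact ih fun j hj => harc j (by omega)

theorem exists_isGeodesic {A : V → V → Prop} {u v : V} {m : ℕ} (h : ddist A u v = m) :
    ∃ g, IsGeodesic A u m g ∧ g m = v := by
  obtain ⟨g, h0, hg, hinj, harc⟩ := (hasPathN_of_ddist_eq h).exists_nat
  refine ⟨g, ⟨h0, harc, fun i hi => ?_⟩, hg⟩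
  have h1 := ddist_walk_le u (g := g) (i := 0) (n := i) fun j hj => harc _ (by omega)
  have h2 := ddist_walk_le u (g := g) (i := i) (n := m - i) fun j hj => harc _ (by omega)
  rw [h0, ddist_self, zero_add, zero_add] at h1
  rw [Nat.add_sub_cancel' hi, hg, h] at h2
  lift ddist A u (g i) to ℕ using ne_top_of_le_ne_top (ENat.natCast_ne_top i) h1 with d
  norm_cast at h1 h2 ⊢
  omega

theorem ddist_triangle (A : V → V → Prop) (a b c : V) :
    ddist A a c ≤ ddist A a b + ddist A b c := by
  rcases eq_or_ne (ddist A b c) ⊤ with ht | ht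
  · simp [ht]
  obtain ⟨m, hm⟩ := ENat.ne_top_iff_exists.mp ht
  obtain ⟨g, hg, rfl⟩ := exists_isGeodesic hm.symm
  rw [← hm]
  have := ddist_walk_le a (g := g) (i := 0) (n := m) fun j hj => hg.arc _ (by omega)
  rwa [hg.zero, zero_add] at this

theorem reaches_iff_ddist_ne_top {A : V → V → Prop} {u v : V} :
    Reaches A u v ↔ ddist A u v ≠ ⊤ := by
  constructor
  · rintro ⟨n, hn⟩
    exact ne_top_of_le_ne_top (ENat.natCast_ne_top n) (ddist_le_of_hasPathN hn)
  · intro h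
    obtain ⟨m, hm⟩ := ENat.ne_top_iff_exists.mp h
    exact ⟨m, hasPathN_of_ddist_eq hm.symm⟩

theorem Reaches.trans {A : V → V → Prop} {a b c : V} (h₁ : Reaches A a b) (h₂ : Reaches A b c) :
    Reaches A a c := by
  rw [reaches_iff_ddist_ne_top] at *
  exact ne_top_of_le_ne_top (WithTop.add_ne_top.mpr ⟨h₁, h₂⟩) (ddist_triangle A a b c)

theorem Reaches.refl (A : V → V → Prop) (a : V) : Reaches A a a := by
  simp [reaches_iff_ddist_ne_top, ddist_self]

theorem Reaches.of_arc {A : V → V → Prop} {a b : V} (h : A a b) : Reaches A a b := by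
  rw [reaches_iff_ddist_ne_top]
  have := ddist_le_add_one a h
  rw [ddist_self] at this
  exact ne_top_of_le_ne_top (by simp) this

theorem exists_isInitialStrongComponent_reaches [Fintype V] (A : V → V → Prop) (v : V) :
    ∃ t, Reaches A t v ∧
      IsInitialStrongComponent A {u | Reaches A u t ∧ Reaches A t u} := by
  obtain ⟨t, ht, hmin⟩ := Set.exists_min_image {t | Reaches A t v}
    (fun t => {s | Reaches A s t}.ncard) (Set.toFinite _) ⟨v, Reaches.refl A v⟩
  refine ⟨t, ht, ⟨t, rfl⟩, fun a b ha hb hab => ?_⟩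
  have hat : Reaches A a t := (Reaches.of_arc hab).trans hb.1
  refine (hmin a (hat.trans ht)).not_gt (Set.ncard_lt_ncard ?_ (Set.toFinite _))
  refine ⟨fun s hs => Reaches.trans hs hat, fun hsub => ha ⟨hat, ?_⟩⟩
  exact hsub (Reaches.refl A t)

theorem IsGeodesic.inj {A : V → V → Prop} {u : V} {m n : ℕ} {g h : ℕ → V}
    (hg : IsGeodesic A u m g) (hh : IsGeodesic A u n h) {i j : ℕ} (hi : i ≤ m) (hj : j ≤ n)
    (hij : g i = h j) : i = j := by
  have h1 := hg.dist i hi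
  rw [hij, hh.dist j hj] at h1
  exact_mod_cast h1.symm

theorem IsGeodesic.not_arc {A : V → V → Prop} {u w : V} {m n : ℕ} {g : ℕ → V}
    (hg : IsGeodesic A u m g) (hw : ddist A u w = n) {i : ℕ} (hi : i ≤ m) (hin : i + 1 < n) :
    ¬ A (g i) w := by
  intro h
  have := ddist_le_add_one u h
  rw [hg.dist i hi, hw] at this
  norm_cast at this
  omega

theorem IsGeodesic.ne {A : V → V → Prop} {u w : V} {m n : ℕ} {g : ℕ → V}
    (hg : IsGeodesic A u m g) (hw : ddist A u w = n) {i : ℕ} (hi : i ≤ m) (hin : i ≠ n) :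
    g i ≠ w := by
  rintro rfl
  rw [hg.dist i hi] at hw
  exact hin (by exact_mod_cast hw)

section Far

variable {A : V → V → Prop} {k : ℕ} {u w : V} {x : ℕ → V}

/-- A closed detour from `w` through the end of `x` back to `u`, followed by the geodesic `y`. -/
theorem arc_of_detour (hqt : KQuasiTrans A k) (hx : IsGeodesic A u (k + 2) x)
    (hxw : ddist A u w = (k + 2 : ℕ)) (hback : A (x k) u) {m : ℕ} {y : ℕ → V}
    (hy : IsGeodesic A u m y) (hm : m + 1 ≤ k) (h₁ : m + 2 ≤ k → A w (x (m + 2)))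
    (h₂ : m + 1 = k → A w u) : A w (y m) := by
  have hp := hasPathN_of_nat (A := A)
    (fun t => if t = 0 then w else if t ≤ k - 1 - m then x (m + 1 + t) else y (t - (k - m))) k (by
      intro i hi j hj hij
      split_ifs at hij <;> first
        | omega
        | exact absurd hij.symm (hx.ne hxw (by omega) (by omega))
        | exact absurd hij (hx.ne hxw (by omega) (by omega))
        | exact absurd hij.symm (hy.ne hxw (by omega) (by omega))
        | exact absurd hij (hy.ne hxw (by omega) (by omega))
        | (have := hx.inj hx (by omega) (by omega) hij; omega)
        | (have := hx.inj hy (by omega) (by omega) hij; omega)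
        | (have := hy.inj hx (by omega) (by omega) hij; omega)
        | (have := hy.inj hy (by omega) (by omega) hij; omega)) (by
      intro i hi
      rcases Nat.eq_zero_or_pos i with rfl | hpos
      · by_cases hmk : m + 1 = k
        · rw [if_pos rfl, if_neg (Nat.succ_ne_zero 0), if_neg (by omega : ¬ 0 + 1 ≤ k - 1 - m),
            (by omega : 0 + 1 - (k - m) = 0), hy.zero]
          exact h₂ hmk
        · rw [if_pos rfl, if_neg (Nat.succ_ne_zero 0), if_pos (by omega : 0 + 1 ≤ k - 1 - m)]
          exact h₁ (by omega)
      · rw [if_neg hpos.ne', if_neg (Nat.succ_ne_zero i)]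
        rcases lt_trichotomy i (k - 1 - m) with hlt | heq | hgt
        · rw [if_pos hlt.le, if_pos (Nat.succ_le_of_lt hlt)]
          exact hx.arc _ (by omega)
        · rw [if_pos heq.le, if_neg (by omega : ¬ i + 1 ≤ k - 1 - m), (by omega : m + 1 + i = k),
            (by omega : i + 1 - (k - m) = 0), hy.zero]
          exact hback
        · rw [if_neg hgt.not_ge, if_neg (by omega : ¬ i + 1 ≤ k - 1 - m),
            (by omega : i + 1 - (k - m) = i - (k - m) + 1)]
          exact hy.arc _ (by omega))
  rw [if_pos rfl, if_neg (by omega : ¬ k = 0), if_neg (by omega : ¬ k ≤ k - 1 - m),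
    (by omega : k - (k - m) = m)] at hp
  exact (hqt _ _ hp).resolve_right (hy.not_arc hxw le_rfl (by omega))

theorem adj_of_arc_geodesic (hqt : KQuasiTrans A k) {n j : ℕ} {y : ℕ → V}
    (hy : IsGeodesic A u n y) (hk : 1 ≤ k) (hn : n = j + k - 1) (hw : ∀ i, j ≤ i → i ≤ n → y i ≠ w)
    (h : A w (y j)) : A w (y n) ∨ A (y n) w := by
  have hp := hasPathN_of_nat (A := A) (fun t => if t = 0 then w else y (j + t - 1)) k (by
      intro a ha b hb hab
      split_ifs at hab
      · omega
      · exact absurd hab.symm (hw _ (by omega) (by omega))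
      · exact absurd hab (hw _ (by omega) (by omega))
      · have := hy.inj hy (by omega) (by omega) hab
        omega) (by
      intro i hi
      rw [if_neg (Nat.succ_ne_zero i)]
      rcases Nat.eq_zero_or_pos i with rfl | hpos
      · simpa using h
      · rw [if_neg hpos.ne', (by omega : j + (i + 1) - 1 = j + i - 1 + 1)]
        exact hy.arc _ (by omega))
  rw [if_pos rfl, if_neg (by omega : ¬ k = 0), ← hn] at hp
  exact hqt _ _ hp

theorem IsGeodesic.back_arc (hqt : KQuasiTrans A k) (hk : 4 ≤ k) {n i : ℕ}
    (hx : IsGeodesic A u n x) (hi : i + k ≤ n) : A (x (i + k)) (x i) := by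
  have hp := hasPathN_of_nat (A := A) (fun t => x (i + t)) k
    (fun a ha b hb hab => by
      have := hx.inj hx (by omega) (by omega) hab
      omega)
    (fun a ha => hx.arc _ (by omega))
  exact (hqt _ _ hp).resolve_left (hx.not_arc (hx.dist _ hi) (by omega) (by omega))

theorem IsGeodesic.arc_initial (hqt : KQuasiTrans A k) (hk : 4 ≤ k) (hke : Even k)
    (hx : IsGeodesic A u (k + 2) x) :
    ∀ i ≤ k, A (x (k + 2)) (x i) := by
  have hxw := hx.dist (k + 2) le_rfl
  have hback : A (x k) u := by
    have := hx.back_arc hqt hk (i := 0) (by omega)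
    rwa [zero_add, hx.zero] at this
  have hsub : ∀ m ≤ k + 2, IsGeodesic A u m x := fun m hm =>
    ⟨hx.zero, fun i hi => hx.arc i (by omega), fun i hi => hx.dist i (by omega)⟩
  have step : ∀ m, m + 2 ≤ k → A (x (k + 2)) (x (m + 2)) → A (x (k + 2)) (x m) := fun m hm h =>
    arc_of_detour hqt hx hxw hback (hsub m (by omega)) (by omega) (fun _ => h) (by omega)
  have h2 : A (x (k + 2)) (x 2) := by
    have := hx.back_arc hqt hk (i := 2) (by omega)
    rwa [add_comm 2 k] at this
  have h0 := step 0 (by omega) h2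
  have hlast : A (x (k + 2)) (x (k - 1)) :=
    arc_of_detour hqt hx hxw hback (hsub _ (by omega)) (by omega) (by omega)
      fun _ => hx.zero ▸ h0
  obtain ⟨r, hr⟩ := hke
  have hodd : ∀ j < r, A (x (k + 2)) (x (k - 1 - 2 * j)) := by
    intro j
    induction j with
    | zero => intro _; exact hlast
    | succ j ih =>
      intro hj
      refine step _ (by omega) ?_
      rw [(by omega : k - 1 - 2 * (j + 1) + 2 = k - 1 - 2 * j)]
      exact ih (by omega)
  have h1 : A (x (k + 2)) (x 1) := by
    have := hodd (r - 1) (by omega)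
    rwa [(by omega : k - 1 - 2 * (r - 1) = 1)] at this
  have hk' : A (x (k + 2)) (x k) :=
    (adj_of_arc_geodesic hqt (hsub k (by omega)) (by omega) (by omega)
      (fun i _ hi => hx.ne hxw (by omega) (by omega)) h1).resolve_right
        (hx.not_arc hxw (by omega) (by omega))
  have heven : ∀ j ≤ r, A (x (k + 2)) (x (k - 2 * j)) := by
    intro j
    induction j with
    | zero => intro _; exact hk'
    | succ j ih =>
      intro hj
      refine step _ (by omega) ?_
      rw [(by omega : k - 2 * (j + 1) + 2 = k - 2 * j)]
      exact ih (by omega)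
  intro i hi
  rcases Nat.even_or_odd' i with ⟨c, rfl | rfl⟩
  · have := heven (r - c) (by omega)
    rwa [(by omega : k - 2 * (r - c) = 2 * c)] at this
  · have := hodd (r - 1 - c) (by omega)
    rwa [(by omega : k - 1 - 2 * (r - 1 - c) = 2 * c + 1)] at this

theorem arc_of_ddist_lt (hqt : KQuasiTrans A k) (hk : 4 ≤ k) (hke : Even k)
    (hw : ddist A u w = (k + 2 : ℕ)) {v : V} {m : ℕ} (hm : m < k) (hv : ddist A u v = m) :
    A w v := by
  obtain ⟨x, hx, rfl⟩ := exists_isGeodesic hw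
  obtain ⟨y, hy, rfl⟩ := exists_isGeodesic hv
  have hback : A (x k) u := by
    have := hx.back_arc hqt hk (i := 0) (by omega)
    rwa [zero_add, hx.zero] at this
  have hinit := hx.arc_initial hqt hk hke
  exact arc_of_detour hqt hx hw hback hy (by omega) (fun h => hinit _ h)
    fun _ => hx.zero ▸ hinit 0 (by omega)

theorem adj_of_ddist_le (hqt : KQuasiTrans A k) (hk : 4 ≤ k) (hke : Even k)
    (hw : ddist A u w = (k + 2 : ℕ)) {v : V} (hvw : v ≠ w) (hv : ddist A u v ≤ (k + 2 : ℕ)) :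
    A w v ∨ A v w := by
  obtain ⟨m, hm⟩ := ENat.ne_top_iff_exists.mp (ne_top_of_le_ne_top (ENat.natCast_ne_top _) hv)
  rw [← hm] at hv
  norm_cast at hv
  by_cases hmk : m < k
  · exact Or.inl (arc_of_ddist_lt hqt hk hke hw hmk hm.symm)
  obtain ⟨y, hy, rfl⟩ := exists_isGeodesic hm.symm
  refine adj_of_arc_geodesic hqt hy (j := m + 1 - k) (by omega) (by omega) (fun i _ hi => ?_)
    (arc_of_ddist_lt hqt hk hke hw (by omega) (hy.dist _ (by omega)))
  rcases eq_or_ne i m with rfl | hne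
  · exact hvw
  · exact hy.ne hw hi (by omega)

theorem outDegIn_lt_of_ddist_eq [Fintype V] (hloop : ∀ v, ¬ A v v) (hqt : KQuasiTrans A k)
    (hk : 4 ≤ k) (hke : Even k) {C : Set V} (hu : u ∈ C) (hw : ddist A u w = (k + 2 : ℕ)) :
    outDegIn A C u < outDegIn A C w := by
  have hwu : A w u := arc_of_ddist_lt hqt hk hke hw (m := 0) (by omega) (by simp [ddist_self])
  refine Set.ncard_lt_ncard ⟨fun y hy => ⟨hy.1, ?_⟩, fun hsub => ?_⟩ (Set.toFinite _)
  · have h1 := ddist_le_add_one u hy.2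
    rw [ddist_self, zero_add] at h1
    lift ddist A u y to ℕ using ne_top_of_le_ne_top (by simp) h1 with d hd
    norm_cast at h1
    exact arc_of_ddist_lt hqt hk hke hw (by omega) hd.symm
  · exact hloop u (hsub ⟨hu, hwu⟩).2

end Far

theorem isRKing_of_forall_ddist_ne {A : V → V → Prop} {u : V} {r : ℕ}
    (hreach : ∀ v, Reaches A u v) (h : ∀ w, ddist A u w ≠ (r + 1 : ℕ)) : IsRKing A r u := by
  intro z
  by_contra hz
  obtain ⟨m, hm⟩ := ENat.ne_top_iff_exists.mp (reaches_iff_ddist_ne_top.mp (hreach z))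
  rw [← hm] at hz
  norm_cast at hz
  obtain ⟨y, hy, -⟩ := exists_isGeodesic hm.symm
  exact h _ (hy.dist (r + 1) (by omega))

theorem exists_arc_of_reaches {A : V → V → Prop} {p : V → Prop} {a b : V} (h : Reaches A a b)
    (ha : ¬ p a) (hb : p b) : ∃ c d, ¬ p c ∧ p d ∧ A c d := by
  obtain ⟨n, hn⟩ := h
  obtain ⟨g, rfl, rfl, -, harc⟩ := hn.exists_nat
  by_contra! hcon
  have : ∀ i ≤ n, ¬ p (g i) := by
    intro i
    induction i with
    | zero => exact fun _ => ha
    | succ i ih => exact fun hi hp => hcon _ _ (ih (by omega)) hp (harc i (by omega))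
  exact this n le_rfl hb

/-- even `k ≥ 4`, unique initial strong component `C`; either every vertex of
`C` is a `(k+1)`-king, or there are `u₁, u₂, u₃ ∈ C` with `u₁` a `(k+1)`-king, `u₂` a
`(k+2)`-king, `u₂ → u₁`, `d(u₂,u₃) = k+2`, `u₃` a `2`-king, and every vertex at distance
`k+2` from `u₂` a `3`-king. -/
theorem kqt_even_structure
    [Fintype V] (A : V → V → Prop) (hloop : ∀ v : V, ¬ A v v)
    (k : ℕ) (hk : 4 ≤ k) (hke : Even k) (hqt : KQuasiTrans A k)
    (C : Set V) (hC : IsInitialStrongComponent A C)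
    (huniq : ∀ S : Set V, IsInitialStrongComponent A S → S = C) :
    (∀ v ∈ C, IsRKing A (k + 1) v) ∨
      (∃ u₁ ∈ C, ∃ u₂ ∈ C, ∃ u₃ ∈ C,
        IsRKing A (k + 1) u₁ ∧ IsRKing A (k + 2) u₂ ∧ A u₂ u₁ ∧
        ddist A u₂ u₃ = ((k : ℕ∞) + 2) ∧ IsRKing A 2 u₃ ∧
        ∀ w : V, ddist A u₂ w = ((k : ℕ∞) + 2) → IsRKing A 3 w) := by
  have hreach : ∀ u ∈ C, ∀ v, Reaches A u v := by
    intro u hu v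
    obtain ⟨t, htv, ht⟩ := exists_isInitialStrongComponent_reaches A v
    rw [← huniq _ ht] at hu
    exact hu.1.trans htv
  have hin : ∀ a b, A a b → b ∈ C → a ∈ C := fun a b hab hb => by
    by_contra ha
    exact hC.2 a b ha hb hab
  rw [or_iff_not_imp_left]
  intro hnot
  push Not at hnot
  obtain ⟨v₀, hv₀, hv₀k⟩ := hnot
  have hmem : ∀ u ∈ C, ∀ w, ddist A u w = (k + 2 : ℕ) → w ∈ C := fun u hu w hw =>
    hin w u (arc_of_ddist_lt hqt hk hke hw (m := 0) (by omega) (by simp [ddist_self])) hu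
  obtain ⟨g, hg, hgmax⟩ := Set.exists_max_image C (outDegIn A C) (Set.toFinite _) ⟨v₀, hv₀⟩
  have hgk : IsRKing A (k + 1) g := isRKing_of_forall_ddist_ne (hreach g hg) fun w hw =>
    (hgmax w (hmem g hg w hw)).not_gt (outDegIn_lt_of_ddist_eq hloop hqt hk hke hg hw)
  obtain ⟨u₂, u₁, hu₂, ⟨hu₁, hu₁k⟩, harc⟩ := exists_arc_of_reaches
    (p := fun v => v ∈ C ∧ IsRKing A (k + 1) v) (hreach v₀ hv₀ g) (fun h => hv₀k h.2) ⟨hg, hgk⟩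
  have hu₂C : u₂ ∈ C := hin _ _ harc hu₁
  have hu₂k : IsRKing A (k + 2) u₂ := by
    intro z
    have h1 := ddist_le_add_one u₂ harc
    rw [ddist_self, zero_add] at h1
    refine (ddist_triangle A u₂ u₁ z).trans ((add_le_add h1 (hu₁k z)).trans ?_)
    exact_mod_cast (by omega : 1 + (k + 1) ≤ k + 2)
  have hfar : ∃ w, ddist A u₂ w = (k + 2 : ℕ) := by
    by_contra! hcon
    exact hu₂ ⟨hu₂C, isRKing_of_forall_ddist_ne (hreach u₂ hu₂C) hcon⟩
  have hadj : ∀ w, ddist A u₂ w = (k + 2 : ℕ) → ∀ v, v ≠ w → A w v ∨ A v w :=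
    fun w hw v hvw => adj_of_ddist_le hqt hk hke hw hvw (hu₂k v)
  have two_step : ∀ {a b c : V}, A a b → A b c → ddist A a c ≤ 2 := by
    intro a b c hab hbc
    have h1 := ddist_le_add_one a hab
    rw [ddist_self, zero_add] at h1
    refine (ddist_le_add_one a hbc).trans ((add_le_add_left h1 1).trans ?_)
    norm_num
  have one_step : ∀ {a b : V}, A a b → ddist A a b ≤ 2 := by
    intro a b hab
    have h1 := ddist_le_add_one a hab
    rw [ddist_self, zero_add] at h1
    exact h1.trans (by norm_num)
  -- a vertex far from `w` is itself at distance `k + 2` from `u₂`, entered from a non-out-neighbour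
  have hpred : ∀ w, ddist A u₂ w = (k + 2 : ℕ) → ∀ v, 2 < ddist A w v →
      ddist A u₂ v = (k + 2 : ℕ) ∧ ∃ b, A b v ∧ ddist A u₂ b = (k + 1 : ℕ) := by
    intro w hw v hv
    have hwu : A w u₂ := arc_of_ddist_lt hqt hk hke hw (m := 0) (by omega) (by simp [ddist_self])
    have hvk := hu₂k v
    obtain ⟨m, hm⟩ := ENat.ne_top_iff_exists.mp (ne_top_of_le_ne_top (ENat.natCast_ne_top _) hvk)
    rw [← hm] at hvk
    norm_cast at hvk
    obtain ⟨y, hy, rfl⟩ := exists_isGeodesic hm.symm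
    rcases m with _ | m
    · rw [hy.zero] at hv
      exact absurd (one_step hwu) hv.not_ge
    have harc' := hy.arc m (by omega)
    have hbw : A (y m) w := by
      refine (hadj w hw (y m) ?_).resolve_left fun h => (two_step h harc').not_gt hv
      intro h
      rw [h] at harc'
      exact (one_step harc').not_gt hv
    have hmk : ¬ m + 1 < k + 2 := fun h => hy.not_arc hw (by omega) h hbw
    obtain rfl : m = k + 1 := by omega
    exact ⟨hy.dist _ le_rfl, y (k + 1), harc', hy.dist _ (by omega)⟩
  obtain ⟨u₃, hu₃, hmax⟩ := Set.exists_max_image {w | ddist A u₂ w = (k + 2 : ℕ)} (outDegIn A C)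
    (Set.toFinite _) hfar
  refine ⟨u₁, hu₁, u₂, hu₂C, u₃, hmem u₂ hu₂C u₃ hu₃, hu₁k, hu₂k, harc, by exact_mod_cast hu₃,
    fun v => ?_, fun w hw v => ?_⟩
  · by_contra hv
    rw [not_le] at hv
    have hvd := (hpred u₃ hu₃ v hv).1
    have hne : u₃ ≠ v := by
      rintro rfl
      simp [ddist_self] at hv
    have hvu : A v u₃ := (hadj v hvd u₃ hne).resolve_right fun h => (one_step h).not_gt hv
    refine (hmax v hvd).not_gt (Set.ncard_lt_ncard ⟨fun y hy => ⟨hy.1, ?_⟩, fun hsub => ?_⟩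
      (Set.toFinite _))
    · refine (hadj v hvd y ?_).resolve_right fun h => (two_step hy.2 h).not_gt hv
      rintro rfl
      exact (one_step hy.2).not_gt hv
    · exact hloop u₃ (hsub ⟨hmem u₂ hu₂C u₃ hu₃, hvu⟩).2
  · by_contra hv
    rw [not_le] at hv
    have hw' : ddist A u₂ w = (k + 2 : ℕ) := by exact_mod_cast hw
    obtain ⟨-, b, hbv, hb⟩ := hpred w hw' v (lt_trans (by norm_num) hv)
    have hwb : 2 < ddist A w b := by
      by_contra! h
      refine (((ddist_le_add_one w hbv).trans (add_le_add_left h 1)).trans ?_).not_gt hv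
      norm_num
    have := (hpred w hw' b hwb).1
    rw [hb] at this
    norm_cast at this
    omega
end

section
/- Let k ≥ 5 be an odd integer and let D be a k-quasi-transitive digraph with a unique initial strong component C having exactly n vertices. Then: (1) if n ≤ k, the number of (k−1)-kings of D is exactly n; (2) if n = k+1, the number of k-kings of D is exactly k+1; (3) if n ≥ k+2, then D has at least k+2 (k+1)-kings. -/
variable {V : Type*}

/-- A directed path of length `n` from `u` to `v` all of whose vertices lie in `S`. -/
def PathIn (A : V → V → Prop) (S : Set V) (n : ℕ) (u v : V) : Prop :=
  ∃ p : ℕ → V, p 0 = u ∧ p n = v ∧ (∀ i < n, A (p i) (p (i + 1))) ∧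
    Set.InjOn p (Set.Iic n) ∧ ∀ i ≤ n, p i ∈ S

theorem PathIn.single {A : V → V → Prop} (u : V) : PathIn A {u} 0 u u :=
  ⟨fun _ => u, rfl, rfl, by simp, by
    intro i hi j hj _
    simp only [Set.mem_Iic] at hi hj
    omega, by simp⟩

theorem PathIn.append {A : V → V → Prop} {S T : Set V} {n m l : ℕ} {u v u' v' : V}
    (h : PathIn A S n u v) (hv : A v u') (h' : PathIn A T m u' v') (hST : Disjoint S T)
    (hl : l = n + 1 + m) : PathIn A (S ∪ T) l u v' := by
  subst hl
  obtain ⟨p, hp0, hpn, hpa, hpi, hpS⟩ := h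
  obtain ⟨q, hq0, hqm, hqa, hqi, hqT⟩ := h'
  have hne : ∀ i ≤ n, ∀ j ≤ m, p i ≠ q j := fun i hi j hj e =>
    Set.disjoint_left.1 hST (hpS i hi) (e ▸ hqT j hj)
  refine ⟨fun i => if i ≤ n then p i else q (i - (n + 1)), by simp [hp0], ?_, ?_, ?_, ?_⟩
  · have : ¬ n + 1 + m ≤ n := by omega
    simp [this, hqm]
  · intro i hi
    rcases lt_trichotomy i n with h1 | h1 | h1
    · simpa [h1.le, Nat.succ_le_of_lt h1] using hpa i h1
    · subst h1
      simpa [hpn, hq0] using hv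
    · have h2 : ¬ i ≤ n := by omega
      have h3 : ¬ i + 1 ≤ n := by omega
      have h4 : i + 1 - (n + 1) = i - (n + 1) + 1 := by omega
      simp only [h2, h3, if_false, h4]
      exact hqa _ (by omega)
  · intro i hi j hj hij
    simp only [Set.mem_Iic] at hi hj
    by_cases h1 : i ≤ n <;> by_cases h2 : j ≤ n <;> simp only [h1, h2, if_true, if_false] at hij
    · exact hpi h1 h2 hij
    · exact absurd hij (hne i h1 _ (by omega))
    · exact absurd hij.symm (hne j h2 _ (by omega))
    · have := hqi (show i - (n + 1) ∈ Set.Iic m by simp; omega)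
        (show j - (n + 1) ∈ Set.Iic m by simp; omega) hij
      omega
  · intro i hi
    by_cases h1 : i ≤ n
    · simpa [h1] using Or.inl (hpS i h1)
    · simpa [h1] using Or.inr (hqT (i - (n + 1)) (by omega))

theorem PathIn.hasPathN {A : V → V → Prop} {S : Set V} {n : ℕ} {u v : V}
    (h : PathIn A S n u v) : HasPathN A u v n := by
  obtain ⟨p, hp0, hpn, hpa, hpi, -⟩ := h
  refine ⟨fun i => p i, ?_, by simpa using hp0, by simpa using hpn, fun i => ?_⟩
  · intro i j hij
    exact Fin.ext (hpi (Set.mem_Iic.2 (Nat.lt_succ_iff.1 i.2))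
      (Set.mem_Iic.2 (Nat.lt_succ_iff.1 j.2)) hij)
  · simpa using hpa i i.2

theorem PathIn.mono {A : V → V → Prop} {S T : Set V} {n : ℕ} {u v : V}
    (h : PathIn A S n u v) (hST : S ⊆ T) : PathIn A T n u v := by
  obtain ⟨p, h0, hn, ha, hi, hS⟩ := h
  exact ⟨p, h0, hn, ha, hi, fun i hi => hST (hS i hi)⟩

/-- There is a directed walk of length at most `r` from `u` to `v`. -/
def Near (A : V → V → Prop) : ℕ → V → V → Prop
  | 0, u, v => u = v
  | r + 1, u, v => u = v ∨ ∃ z, A u z ∧ Near A r z v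

theorem Near.refl {A : V → V → Prop} (r : ℕ) (u : V) : Near A r u u := by
  cases r with
  | zero => rfl
  | succ r => exact Or.inl rfl

theorem Near.cons {A : V → V → Prop} {r : ℕ} {u z v : V} (h : A u z) (h' : Near A r z v) :
    Near A (r + 1) u v := Or.inr ⟨z, h, h'⟩

theorem Near.mono {A : V → V → Prop} {r s : ℕ} {u v : V} (h : Near A r u v) (hrs : r ≤ s) :
    Near A s u v := by
  induction r generalizing s u with
  | zero => exact h ▸ Near.refl s u
  | succ r ih =>
    obtain rfl | ⟨z, hz, h⟩ := h
    · exact Near.refl s u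
    · obtain ⟨s, rfl⟩ : ∃ t, s = t + 1 := ⟨s - 1, by omega⟩
      exact Near.cons hz (ih h (by omega))

theorem Near.trans {A : V → V → Prop} {r s : ℕ} {u v z : V} (h : Near A r u v)
    (h' : Near A s v z) : Near A (r + s) u z := by
  induction r generalizing u with
  | zero => exact h ▸ h'.mono (by omega)
  | succ r ih =>
    obtain rfl | ⟨y, hy, h⟩ := h
    · exact h'.mono (by omega)
    · exact (Near.cons hy (ih h)).mono (by omega)

theorem Near.single {A : V → V → Prop} {u v : V} (h : A u v) : Near A 1 u v :=
  Near.cons h (Near.refl 0 v)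

theorem Near.exists_pathIn {A : V → V → Prop} {r : ℕ} {u v : V} (h : Near A r u v) :
    ∃ n ≤ r, PathIn A Set.univ n u v := by
  induction r generalizing u with
  | zero => exact h ▸ ⟨0, le_rfl, (PathIn.single u).mono (Set.subset_univ _)⟩
  | succ r ih =>
    obtain rfl | ⟨z, hz, h⟩ := h
    · exact ⟨0, by omega, (PathIn.single u).mono (Set.subset_univ _)⟩
    · obtain ⟨n, hn, p, hp0, hpn, hpa, hpi, -⟩ := ih h
      by_cases hu : ∃ i ≤ n, p i = u
      · obtain ⟨i, hi, rfl⟩ := hu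
        refine ⟨n - i, by omega, fun j => p (i + j), rfl, ?_, ?_, ?_, by simp⟩
        · change p (i + (n - i)) = v
          rw [Nat.add_sub_cancel' hi, hpn]
        · exact fun j hj => hpa (i + j) (by omega)
        · intro a ha b hb hab
          simp only [Set.mem_Iic] at ha hb
          have := hpi (show i + a ∈ Set.Iic n by simp; omega)
            (show i + b ∈ Set.Iic n by simp; omega) hab
          omega
      · push Not at hu
        have hp : PathIn A {u}ᶜ n z v := ⟨p, hp0, hpn, hpa, hpi, hu⟩
        exact ⟨n + 1, by omega, ((PathIn.single u).append hz hp (by simp) (by omega)).mono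
          (Set.subset_univ _)⟩

theorem Near.reflTransGen {A : V → V → Prop} {r : ℕ} {u v : V} (h : Near A r u v) :
    Relation.ReflTransGen A u v := by
  induction r generalizing u with
  | zero => exact h ▸ Relation.ReflTransGen.refl
  | succ r ih =>
    obtain rfl | ⟨z, hz, h⟩ := h
    · exact Relation.ReflTransGen.refl
    · exact (ih h).head hz

theorem HasPathN.near {A : V → V → Prop} {n : ℕ} {u v : V} (h : HasPathN A u v n) :
    Near A n u v := by
  obtain ⟨f, -, rfl, rfl, ha⟩ := h
  have : ∀ m (hm : m ≤ n), Near A m (f 0) (f ⟨m, by omega⟩) := by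
    intro m
    induction m with
    | zero => exact fun _ => rfl
    | succ m ih => exact fun hm => (ih (by omega)).trans (Near.single (ha ⟨m, by omega⟩))
  exact this n le_rfl

theorem ddist_le_iff {A : V → V → Prop} {r : ℕ} {u v : V} :
    ddist A u v ≤ (r : ℕ∞) ↔ Near A r u v := by
  constructor
  · intro h
    have hne : {n : ℕ∞ | ∃ m : ℕ, n = (m : ℕ∞) ∧ HasPathN A u v m}.Nonempty := by
      by_contra hne
      rw [Set.not_nonempty_iff_eq_empty] at hne
      rw [ddist, hne, sInf_empty] at h
      exact absurd h (by simp)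
    obtain ⟨m, hm, hp⟩ := csInf_mem hne
    rw [ddist, hm] at h
    exact hp.near.mono (by exact_mod_cast h)
  · intro h
    obtain ⟨n, hn, hp⟩ := h.exists_pathIn
    have hle : ddist A u v ≤ (n : ℕ∞) := sInf_le ⟨n, rfl, hp.hasPathN⟩
    exact hle.trans (by exact_mod_cast hn)

theorem isRKing_iff {A : V → V → Prop} {r : ℕ} {v : V} :
    IsRKing A r v ↔ ∀ u, Near A r v u := forall_congr' fun _ => ddist_le_iff

theorem reaches_iff {A : V → V → Prop} {u v : V} :
    Reaches A u v ↔ Relation.ReflTransGen A u v := by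
  constructor
  · rintro ⟨n, h⟩
    exact h.near.reflTransGen
  · intro h
    have : ∃ r, Near A r u v := by
      induction h with
      | refl => exact ⟨0, rfl⟩
      | tail _ hab ih =>
        obtain ⟨r, hr⟩ := ih
        exact ⟨r + 1, hr.trans (Near.single hab)⟩
    obtain ⟨r, hr⟩ := this
    obtain ⟨n, -, hp⟩ := hr.exists_pathIn
    exact ⟨n, hp.hasPathN⟩

/-- `x 0, …, x n` is a path that climbs one level of `ℓ` at each step. -/
def Ascends (A : V → V → Prop) (ℓ : V → ℕ) (x : ℕ → V) (n : ℕ) : Prop :=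
  (∀ i ≤ n, ℓ (x i) = i) ∧ ∀ i < n, A (x i) (x (i + 1))

/-- `ℓ` is the distance function from some root. -/
structure IsLevel (A : V → V → Prop) (ℓ : V → ℕ) : Prop where
  step : ∀ u v, A u v → ℓ v ≤ ℓ u + 1
  root : ∀ u v, ℓ u = 0 → ℓ v = 0 → u = v
  exists_ascends : ∀ v, ∃ x, Ascends A ℓ x (ℓ v) ∧ x (ℓ v) = v

section Levels

variable {A : V → V → Prop} {ℓ : V → ℕ} {k : ℕ}

theorem Ascends.mono {x : ℕ → V} {n m : ℕ} (h : Ascends A ℓ x n) (hm : m ≤ n) :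
    Ascends A ℓ x m :=
  ⟨fun i hi => h.1 i (hi.trans hm), fun i hi => h.2 i (hi.trans_le hm)⟩

theorem Ascends.pathIn_of {x : ℕ → V} {n i j d : ℕ} {S : Set V} (h : Ascends A ℓ x n)
    (hj : j ≤ n) (hd : i + d = j) (hS : ∀ t, i ≤ t → t ≤ j → x t ∈ S) :
    PathIn A S d (x i) (x j) := by
  refine ⟨fun t => x (i + t), rfl, by simp [hd], fun t ht => h.2 (i + t) (by omega), ?_,
    fun t ht => hS _ (by omega) (by omega)⟩
  intro a ha b hb hab
  simp only [Set.mem_Iic] at ha hb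
  have h1 := h.1 (i + a) (by omega)
  have h2 := h.1 (i + b) (by omega)
  simp only at hab
  rw [hab] at h1
  omega

theorem Ascends.pathIn {x : ℕ → V} {n i j d : ℕ} (h : Ascends A ℓ x n) (hj : j ≤ n)
    (hd : i + d = j) : PathIn A {v | i ≤ ℓ v ∧ ℓ v ≤ j} d (x i) (x j) :=
  h.pathIn_of hj hd fun t h1 h2 => by
    change i ≤ ℓ (x t) ∧ ℓ (x t) ≤ j
    rw [h.1 t (by omega)]
    exact ⟨h1, h2⟩

theorem Ascends.near {x : ℕ → V} {n i j : ℕ} (h : Ascends A ℓ x n) (hj : j ≤ n)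
    (hij : i ≤ j) : Near A (j - i) (x i) (x j) := by
  obtain ⟨d, rfl⟩ := Nat.exists_eq_add_of_le hij
  rw [Nat.add_sub_cancel_left]
  clear hij
  induction d with
  | zero => exact Near.refl _ _
  | succ d ih => exact (ih (by omega)).trans (Near.single (h.2 (i + d) (by omega)))

/-- Two ascending paths that meet at level `j` can be spliced there. -/
theorem Ascends.splice {x y : ℕ → V} {j n : ℕ} (hx : Ascends A ℓ x j) (hy : Ascends A ℓ y n)
    (hjn : j < n) (hxy : A (x j) (y (j + 1))) :
    Ascends A ℓ (fun i => if i ≤ j then x i else y i) n := by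
  refine ⟨fun i hi => ?_, fun i hi => ?_⟩
  · by_cases h : i ≤ j
    · simpa [h] using hx.1 i h
    · simpa [h] using hy.1 i hi
  · rcases lt_trichotomy i j with h | rfl | h
    · simpa [h.le, Nat.succ_le_of_lt h] using hx.2 i h
    · simpa using hxy
    · simpa [not_le.2 h, show ¬ i + 1 ≤ j by omega] using hy.2 i hi

theorem disjoint_levels {a b c d : ℕ} (h : b < c ∨ d < a) :
    Disjoint {v | a ≤ ℓ v ∧ ℓ v ≤ b} {v | c ≤ ℓ v ∧ ℓ v ≤ d} := by
  rw [Set.disjoint_left]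
  rintro v ⟨h1, h2⟩ ⟨h3, h4⟩
  omega

theorem PathIn.single_level (u : V) {a : ℕ} (h : ℓ u = a) :
    PathIn A {v | a ≤ ℓ v ∧ ℓ v ≤ a} 0 u u :=
  (PathIn.single u).mono (by simp [h])

theorem KQuasiTrans.adj (hq : KQuasiTrans A k) {S : Set V} {u v : V} (h : PathIn A S k u v) :
    A u v ∨ A v u := hq u v h.hasPathN

namespace IsLevel

theorem not_arc (L : IsLevel A ℓ) {u v : V} (h : ℓ u + 2 ≤ ℓ v) : ¬ A u v := fun ha => by
  have := L.step _ _ ha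
  omega

theorem arc_of_adj (L : IsLevel A ℓ) {u v : V} (h : ℓ v + 2 ≤ ℓ u) (ha : A u v ∨ A v u) : A u v :=
  ha.resolve_right (L.not_arc h)

theorem exists_ascends' (L : IsLevel A ℓ) {v : V} {n : ℕ} (h : ℓ v = n) :
    ∃ x, Ascends A ℓ x n ∧ x n = v :=
  h ▸ L.exists_ascends v

/-- A chord from one ascending path to a lower level of another one yields a path that climbs the
first one, jumps, and climbs the second one. -/
theorem pathIn_cross {x q : ℕ → V} {n m j e b c d : ℕ} (hx : Ascends A ℓ x n)
    (hq : Ascends A ℓ q m) (hje : j ≤ e) (he : e ≤ n) (hbc : b ≤ c) (hc : c ≤ m) (hcj : c < j)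
    (h : A (x e) (q b)) (hd : e + 1 + c = d + j + b) :
    PathIn A {v | b ≤ ℓ v ∧ ℓ v ≤ e} d (x j) (q c) := by
  have h1 := hx.pathIn he (show j + (e - j) = e by omega)
  have h2 := hq.pathIn hc (show b + (c - b) = c by omega)
  refine (h1.append h h2 (disjoint_levels (by omega)) (l := d) (by omega)).mono ?_
  rintro v (⟨h3, h4⟩ | ⟨h3, h4⟩) <;> exact ⟨by omega, by omega⟩

/-- A vertex of level `l` is adjacent to `v` as soon as it has an arc to a vertex `x f` that starts
a suitable path leading to `v` through a cross chord. -/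
theorem adj_of_cross (hqt : KQuasiTrans A k) {x q : ℕ → V} {n m f e b c l : ℕ} {u : V}
    (hx : Ascends A ℓ x n)
    (hq : Ascends A ℓ q m) (hfe : f ≤ e) (he : e ≤ n) (hbc : b ≤ c) (hc : c ≤ m) (hcf : c < f)
    (hu : ℓ u = l) (hl : e < l) (hu' : A u (x f)) (h : A (x e) (q b))
    (hd : e + 2 + c = k + f + b) : A u (q c) ∨ A (q c) u :=
  hqt.adj ((PathIn.single_level u hu).append hu'
    (pathIn_cross hx hq hfe he hbc hc hcf h (d := k - 1) (by omega))
    (disjoint_levels (by omega)) (by omega))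

theorem arc_drop_k (L : IsLevel A ℓ) (hk : 5 ≤ k) (hqt : KQuasiTrans A k) {x : ℕ → V} {n b : ℕ}
    (hx : Ascends A ℓ x n) (hb : b + k ≤ n) : A (x (b + k)) (x b) := by
  have h1 := hx.1 (b + k) hb
  have h2 := hx.1 b (by omega)
  exact L.arc_of_adj (by omega) (hqt.adj (hx.pathIn hb rfl)).symm

theorem arc_drop_k_add_two (L : IsLevel A ℓ) (hk : 5 ≤ k) (hqt : KQuasiTrans A k) {x : ℕ → V}
    {n b : ℕ} (hx : Ascends A ℓ x n) (hb : b + k + 2 ≤ n) : A (x (b + k + 2)) (x b) := by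
  have h1 := hx.1 (b + k + 2) hb
  have h2 := hx.1 b (by omega)
  have h3 := arc_drop_k L hk hqt hx (b := b + 2) (by omega)
  refine L.arc_of_adj (by omega) (adj_of_cross hqt hx hx (f := b + 2) (e := b + k) (b := b) ?_ ?_
    le_rfl ?_ ?_ h1 ?_ ?_ (arc_drop_k L hk hqt hx (by omega)) ?_)
  all_goals first | omega | skip
  rwa [show b + k + 2 = b + 2 + k by omega]

theorem arc_top (L : IsLevel A ℓ) (hk : 5 ≤ k) (hqt : KQuasiTrans A k) {x : ℕ → V}
    {n b : ℕ} (hx : Ascends A ℓ x n) (hb : b + k + 2 ≤ n) (r i : ℕ) (hr : i + 1 + 2 * r = k) :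
    A (x (b + k + 2)) (x (b + i)) := by
  induction r generalizing i with
  | zero =>
    have h1 := hx.1 (b + k + 2) hb
    have h2 := hx.1 (b + i) (by omega)
    have h3 := arc_drop_k_add_two L hk hqt hx hb
    refine L.arc_of_adj (by omega) (hqt.adj ((PathIn.single_level _ h1).append h3
      (hx.pathIn (i := b) (j := b + i) (by omega) rfl) (disjoint_levels (by omega)) (by omega)))
  | succ r ih =>
    have h1 := hx.1 (b + k + 2) hb
    have h2 := hx.1 (b + i) (by omega)
    have h3 := ih (i + 2) (by omega)
    refine L.arc_of_adj (by omega) (adj_of_cross hqt hx hx (f := b + (i + 2)) (e := b + k) (b := b)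
      ?_ ?_ ?_ ?_ ?_ h1 ?_ h3 (arc_drop_k L hk hqt hx (by omega)) ?_)
    all_goals omega

theorem arc_bottom (L : IsLevel A ℓ) (hk : 5 ≤ k) (hqt : KQuasiTrans A k) {x : ℕ → V}
    {n : ℕ} (hx : Ascends A ℓ x n) (hn : k + 2 ≤ n) (r : ℕ) (hr : 2 * r + 3 ≤ k) :
    A (x (2 * r + 3)) (x 0) := by
  have h1 := hx.1 (2 * r + 3) (by omega)
  have h2 := hx.1 0 (by omega)
  refine L.arc_of_adj (by omega) (hqt.adj (S := Set.univ) ?_)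
  cases r with
  | zero =>
    have h3 := arc_drop_k_add_two L hk hqt hx (b := 0) (by omega)
    refine (pathIn_cross hx hx (e := 0 + k + 2) (b := 0) ?_ ?_ ?_ ?_ ?_ h3 ?_).mono
      (Set.subset_univ _)
    all_goals omega
  | succ r =>
    have h3 := arc_bottom L hk hqt hx hn r (by omega)
    have h4 := arc_drop_k L hk hqt hx (b := 1) (by omega)
    refine (((hx.pathIn (i := 2 * (r + 1) + 3) (j := 1 + k) (d := k - 2 * r - 4) (by omega)
      (by omega)).append h4 (pathIn_cross hx hx (j := 1) (e := 2 * r + 3) (b := 0) (c := 0)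
        (d := 2 * r + 3) ?_ ?_ ?_ ?_ ?_ h3 ?_)
      (disjoint_levels (by omega))) (by omega)).mono (Set.subset_univ _)
    all_goals omega

/-- Level `k` dominates the root. -/
theorem arc_levels_k_zero (L : IsLevel A ℓ) (hk : 5 ≤ k) (hqt : KQuasiTrans A k) {u v : V}
    (hu : ℓ u = k) (hv : ℓ v = 0) : A u v := by
  obtain ⟨x, hx, rfl⟩ := L.exists_ascends' hu
  have := arc_drop_k L hk hqt hx (b := 0) (by omega)
  rw [zero_add] at this
  rwa [L.root v (x 0) hv (hx.1 0 (by omega))]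

theorem adj_pred_of_arc (L : IsLevel A ℓ) (hqt : KQuasiTrans A k)
    {x : ℕ → V} {n j e : ℕ} {v : V} (hx : Ascends A ℓ x n) (hje : j ≤ e) (he : e ≤ n)
    (hke : k ≤ e) (hj : e < j + k) (hv : ℓ v + 1 = j)
    (h : ∀ u v, ℓ u = e → ℓ v + k = e → A u v) : A (x j) v ∨ A v (x j) := by
  obtain ⟨q, hq, hqv⟩ := L.exists_ascends v
  rw [← hqv]
  refine hqt.adj (pathIn_cross hx hq hje he (b := e - k) (c := ℓ v) ?_ le_rfl ?_
    (h _ _ (hx.1 e he) ?_) ?_)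
  · omega
  · omega
  · rw [hq.1 _ (by omega)]
    omega
  · omega

/-- If there is a long ascending path, then level `k - 2` dominates the root. -/
theorem arc_levels_k_sub_two_zero (L : IsLevel A ℓ) (hk : 5 ≤ k) (hko : Odd k)
    (hqt : KQuasiTrans A k) {x : ℕ → V} {n : ℕ} (hx : Ascends A ℓ x n) (hn : k + 2 ≤ n) {u v : V}
    (hu : ℓ u + 2 = k) (hv : ℓ v = 0) : A u v := by
  obtain ⟨z, hz, hzu⟩ := L.exists_ascends u
  obtain ⟨a, ha⟩ := hko
  have key : ∀ y : ℕ → V, Ascends A ℓ y (k + 2) → y (k - 2) = u → A u v := fun y hy hyu => by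
    have := arc_bottom L hk hqt hy le_rfl (a - 2) (by omega)
    rw [show 2 * (a - 2) + 3 = k - 2 by omega, hyu] at this
    rwa [L.root v (y 0) hv (hy.1 0 (by omega))]
  obtain h | h := adj_pred_of_arc L hqt hx (j := k - 1) (e := k) (v := u) (by omega)
    (by omega) le_rfl (by omega) (by omega)
    (fun u v hu hv => arc_levels_k_zero L hk hqt hu (by omega))
  · by_cases hux : u = x (k - 2)
    · exact key x (hx.mono hn) hux.symm
    · have h0 := hx.1 0 (by omega)
      rw [L.root v (x 0) hv h0]
      refine L.arc_of_adj (by omega) (hqt.adj ((hx.pathIn_of (i := 0) (j := k - 1) (d := k - 1)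
        (S := {w | w ≠ u}) (by omega) (by omega) fun t _ ht htu => ?_).append h
        (PathIn.single u) (by simp) (by omega))).symm
      subst htu
      rw [hx.1 t (by omega)] at hu
      exact hux (by rw [← hu]; simp)
  · obtain rfl : k = ℓ u + 2 := hu.symm
    refine key _ (hz.splice (hx.mono hn) (by omega) (j := ℓ u) ?_) ?_
    · rw [hzu]
      exact h
    · simpa using hzu

/-- A vertex dominates every vertex lying exactly `k` levels below. -/
theorem arc_levels_k (L : IsLevel A ℓ) (hk : 5 ≤ k) (hko : Odd k)
    (hqt : KQuasiTrans A k) {x : ℕ → V} {n : ℕ} (hx : Ascends A ℓ x n) (hn : k + 2 ≤ n)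
    (c : ℕ) {u v : V} (hu : ℓ u = c + k) (hv : ℓ v = c) : A u v := by
  induction c using Nat.strong_induction_on generalizing u v with
  | _ c ih =>
  obtain ⟨z, hz, rfl⟩ := L.exists_ascends' hu
  obtain ⟨q, hq, rfl⟩ := L.exists_ascends' hv
  obtain rfl | rfl | hc : c = 0 ∨ c = 1 ∨ 2 ≤ c := by omega
  · exact arc_levels_k_zero L hk hqt (by omega) hv
  · have h1 := arc_drop_k L hk hqt hz (b := 1) le_rfl
    by_cases hqz : z 1 = q 1
    · rwa [← hqz]
    have h0 : z 0 = q 0 := L.root _ _ (hz.1 0 (by omega)) (hq.1 0 (by omega))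
    have h2 : A (z (k - 2)) (z 0) := arc_levels_k_sub_two_zero L hk hko hqt hx hn
      (by rw [hz.1 _ (by omega)]; omega) (hz.1 0 (by omega))
    have h3 : A (z 0) (q 1) := h0 ▸ hq.2 0 (by omega)
    have h4 : PathIn A {w | (1 ≤ ℓ w ∧ ℓ w ≤ k - 2) ∧ w ≠ q 1} (k - 3) (z 1) (z (k - 2)) := by
      refine hz.pathIn_of (by omega) (by omega) fun t ht1 ht2 => ⟨?_, fun h => hqz ?_⟩
      · rw [hz.1 t (by omega)]
        exact ⟨ht1, ht2⟩
      · have h5 := hz.1 t (by omega)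
        rw [h, hv] at h5
        rwa [← h5] at h
    have h5 : PathIn A {w | ℓ w ≤ k - 2} (k - 1) (z 1) (q 1) := by
      refine (((h4.append h2 (PathIn.single (z 0)) ?_ rfl).append h3 (PathIn.single (q 1)) ?_
        (by omega))).mono ?_
      · rw [Set.disjoint_singleton_right]
        rintro ⟨⟨h, -⟩, -⟩
        rw [hz.1 0 (by omega)] at h
        omega
      · rw [Set.disjoint_singleton_right]
        rintro (⟨-, h⟩ | h)
        · exact h rfl
        · rw [Set.mem_singleton_iff] at h
          rw [h, hz.1 0 (by omega)] at hv
          omega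
      · rintro w ((⟨⟨-, h⟩, -⟩ | rfl) | rfl)
        · exact h
        · change ℓ (z 0) ≤ k - 2
          rw [hz.1 0 (by omega)]
          omega
        · change ℓ (q 1) ≤ k - 2
          omega
    refine L.arc_of_adj (by omega) (hqt.adj ((PathIn.single (z (1 + k))).append h1 h5 ?_
      (by omega)))
    rw [Set.disjoint_singleton_left]
    change ¬ ℓ (z (1 + k)) ≤ k - 2
    omega
  · obtain ⟨a, ha⟩ := hko
    have h1 := arc_top L hk hqt hz (b := c - 2) (by omega) (a - 2) 4 (by omega)
    rw [show c - 2 + k + 2 = c + k by omega, show c - 2 + 4 = c + 2 by omega] at h1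
    refine L.arc_of_adj (by omega) (adj_of_cross hqt hz hq (f := c + 2) (e := max (c + 2) k)
      (b := max (c + 2) k - k) ?_ ?_ ?_ ?_ ?_ hu ?_ h1 (ih (max (c + 2) k - k) ?_ ?_ ?_) ?_)
    any_goals omega
    · rw [hz.1 _ (by omega)]
      omega
    · exact hq.1 _ (by omega)

theorem arc_levels_k_add_even (L : IsLevel A ℓ) (hk : 5 ≤ k) (hko : Odd k)
    (hqt : KQuasiTrans A k) {x : ℕ → V} {n : ℕ} (hx : Ascends A ℓ x n) (hn : k + 2 ≤ n)
    (r : ℕ) {c : ℕ} {u v : V} (hu : ℓ u = c + k + 2 * r) (hv : ℓ v = c) : A u v := by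
  induction r generalizing c u v with
  | zero => exact arc_levels_k L hk hko hqt hx hn c hu hv
  | succ r ih =>
    obtain ⟨z, hz, rfl⟩ := L.exists_ascends' hu
    obtain ⟨q, hq, rfl⟩ := L.exists_ascends' hv
    have h1 : A (z (c + k + 2 * (r + 1))) (z (c + 2)) := ih (c := c + 2) (by omega)
      (hz.1 _ (by omega))
    have h2 : A (z (max (c + 2) k)) (q (max (c + 2) k - k)) :=
      arc_levels_k L hk hko hqt hx hn (max (c + 2) k - k) (by rw [hz.1 _ (by omega)]; omega)
        (hq.1 _ (by omega))
    refine L.arc_of_adj (by omega) (adj_of_cross hqt hz hq (f := c + 2) (e := max (c + 2) k)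
      (b := max (c + 2) k - k) ?_ ?_ ?_ ?_ ?_ hu ?_ h1 h2 ?_)
    all_goals omega

/-- A vertex dominates every vertex lying an odd number `d ≥ k` of levels below. -/
theorem arc_levels_odd (L : IsLevel A ℓ) (hk : 5 ≤ k) (hko : Odd k)
    (hqt : KQuasiTrans A k) {x : ℕ → V} {n : ℕ} (hx : Ascends A ℓ x n) (hn : k + 2 ≤ n)
    {d : ℕ} (hd : Odd d) (hkd : k ≤ d) {u v : V} (huv : ℓ u = ℓ v + d) : A u v := by
  obtain ⟨a, ha⟩ := id hko
  obtain ⟨b, hb⟩ := hd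
  exact arc_levels_k_add_even L hk hko hqt hx hn (b - a) (c := ℓ v) (by omega) rfl

/-- A vertex of a long ascending path dominates the whole level lying three levels below. -/
theorem arc_drop_three (L : IsLevel A ℓ) (hk : 5 ≤ k) (hko : Odd k)
    (hqt : KQuasiTrans A k) {x : ℕ → V} {n : ℕ} (hx : Ascends A ℓ x n) (hn : k + 2 ≤ n)
    {j : ℕ} (hj : j ≤ n) {v : V} (hv : ℓ v + 3 = j) : A (x j) v := by
  obtain ⟨q, hq, hqv⟩ := L.exists_ascends v
  have h1 : A (x (max j (k + 2))) (q (max j (k + 2) - (k + 2))) :=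
    arc_levels_k_add_even L hk hko hqt hx hn 1 (c := max j (k + 2) - (k + 2))
      (by rw [hx.1 _ (by omega)]; omega) (hq.1 _ (by omega))
  have h2 := hx.1 j hj
  refine L.arc_of_adj (by omega) ?_
  rw [← hqv]
  refine hqt.adj (pathIn_cross hx hq (by omega) ?_ ?_ le_rfl ?_ h1 ?_)
  all_goals omega

theorem adj_pred (L : IsLevel A ℓ) (hk : 5 ≤ k) (hko : Odd k)
    (hqt : KQuasiTrans A k) {x : ℕ → V} {n : ℕ} (hx : Ascends A ℓ x n) (hn : k + 2 ≤ n)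
    {y : ℕ → V} {e j : ℕ} (hy : Ascends A ℓ y e) (he : k ≤ e) (hj : j ≤ e) {v : V}
    (hv : ℓ v + 1 = j) : A (y j) v ∨ A v (y j) := by
  refine adj_pred_of_arc L hqt hy (e := max j k) ?_ ?_ ?_ ?_ hv fun u v hu hv =>
    arc_levels_k L hk hko hqt hx hn (ℓ v) (by omega) rfl
  all_goals omega

theorem near_up (L : IsLevel A ℓ) (hk : 5 ≤ k) (hko : Odd k)
    (hqt : KQuasiTrans A k) {x : ℕ → V} {n : ℕ} (hx : Ascends A ℓ x n) (hn : k + 2 ≤ n)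
    {i : ℕ} (hi : i ≤ n) {t : V} (ht : i ≤ ℓ t) : Near A (ℓ t - i + 4) (x i) t := by
  obtain ⟨q, hq, hqt'⟩ := L.exists_ascends t
  by_cases h3 : 3 ≤ i
  · have h1 : A (x i) (q (i - 3)) := arc_drop_three L hk hko hqt hx hn hi
      (by rw [hq.1 _ (by omega)]; omega)
    have h2 := hq.near (i := i - 3) le_rfl (by omega)
    rw [hqt'] at h2
    exact (Near.cons h1 h2).mono (by omega)
  · have h1 : A (x (i + 3)) (q i) := arc_drop_three L hk hko hqt hx hn (by omega)
      (by rw [hq.1 _ (by omega)])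
    have h2 := hq.near le_rfl ht
    rw [hqt'] at h2
    exact ((hx.near (i := i) (j := i + 3) (by omega) (by omega)).trans (Near.cons h1 h2)).mono
      (by omega)

theorem near_down_short (L : IsLevel A ℓ) (hk : 5 ≤ k) (hko : Odd k)
    (hqt : KQuasiTrans A k) {x : ℕ → V} {n : ℕ} (hx : Ascends A ℓ x n) (hn : k + 2 ≤ n)
    (d : ℕ) {i : ℕ} (hi : i ≤ n) {t : V} (ht : ℓ t + d = i) :
    Near A (max 4 (d + 1)) (x i) t := by
  induction d using Nat.strong_induction_on generalizing i with
  | _ d ih =>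
  by_cases hd : 4 ≤ d
  · have h1 : A (x i) (x (i - 3)) := arc_drop_three L hk hko hqt hx hn hi
      (by rw [hx.1 _ (by omega)]; omega)
    exact (Near.cons h1 (ih (d - 3) (by omega) (by omega) (by omega))).mono (by omega)
  · by_cases h3 : 3 ≤ i
    · obtain ⟨q, hq, hqt'⟩ := L.exists_ascends t
      have h1 : A (x i) (q (i - 3)) := arc_drop_three L hk hko hqt hx hn hi
        (by rw [hq.1 _ (by omega)]; omega)
      have h2 := hq.near (i := i - 3) le_rfl (by omega)
      rw [hqt'] at h2
      exact (Near.cons h1 h2).mono (by omega)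
    · have h1 : A (x (ℓ t + 3)) t := arc_drop_three L hk hko hqt hx hn (by omega) rfl
      exact ((hx.near (i := i) (j := ℓ t + 3) (by omega) (by omega)).trans (Near.single h1)).mono
        (by omega)

/-- A vertex of a long ascending path is close to every vertex that is not much higher. -/
theorem near_of_level_lt (L : IsLevel A ℓ) (hk : 5 ≤ k) (hko : Odd k)
    (hqt : KQuasiTrans A k) {x : ℕ → V} {n : ℕ} (hx : Ascends A ℓ x n) (hn : k + 2 ≤ n)
    {i : ℕ} (hi : i ≤ n) {t : V} (ht : ℓ t + 3 ≤ i + k) : Near A (k + 1) (x i) t := by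
  by_cases h1 : i ≤ ℓ t
  · exact (near_up L hk hko hqt hx hn hi h1).mono (by omega)
  obtain ⟨d, hd⟩ := Nat.exists_eq_add_of_le (not_le.1 h1).le
  by_cases h2 : d < k
  · exact (near_down_short L hk hko hqt hx hn d hi hd.symm).mono (by omega)
  have hxi := hx.1 i hi
  obtain h3 | h3 := Nat.even_or_odd d
  · obtain ⟨a, ha⟩ := hko
    obtain ⟨b, hb⟩ := h3
    have hxt := hx.1 (ℓ t + 1) (by omega)
    have h4 : A (x i) (x (ℓ t + 1)) := arc_levels_odd L hk ⟨a, ha⟩ hqt hx hn (d := d - 1)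
      ⟨b - 1, by omega⟩ (by omega) (by omega)
    exact (Near.cons h4 (near_down_short L hk ⟨a, ha⟩ hqt hx hn 1 (by omega) rfl)).mono
      (by omega)
  · exact (Near.single (arc_levels_odd L hk hko hqt hx hn h3 (by omega) (by omega))).mono
      (by omega)

end IsLevel

/-- The out-neighbours of `y` one level up that are adjacent to the whole level of `y`. -/
def fullOut (A : V → V → Prop) (ℓ : V → ℕ) (y : V) : Set V :=
  {u | ℓ u = ℓ y + 1 ∧ A y u ∧ ∀ v, ℓ v = ℓ y → A u v ∨ A v u}

namespace IsLevel

theorem exists_greedy (L : IsLevel A ℓ) [Finite V] (f : V → ℕ) (n : ℕ) {v : V} (hv : ℓ v = n) :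
    ∃ x, Ascends A ℓ x n ∧ x n = v ∧ ∀ i < n, ∀ y, ℓ y = i → A y (x (i + 1)) →
      f y ≤ f (x i) := by
  induction n generalizing v with
  | zero =>
    obtain ⟨x, hx, hxv⟩ := L.exists_ascends' hv
    exact ⟨x, hx, hxv, by simp⟩
  | succ n ih =>
    have hne : {y | ℓ y = n ∧ A y v}.Nonempty := by
      obtain ⟨x, hx, rfl⟩ := L.exists_ascends' hv
      exact ⟨x n, hx.1 n (by omega), hx.2 n (by omega)⟩
    obtain ⟨y, ⟨hy, hyv⟩, hmax⟩ := Set.exists_max_image _ f (Set.toFinite _) hne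
    obtain ⟨x, hx, rfl, hgreedy⟩ := ih hy
    refine ⟨fun i => if i ≤ n then x i else v, ⟨fun i hi => ?_, fun i hi => ?_⟩, by simp,
      fun i hi z hz hzi => ?_⟩
    · by_cases h : i ≤ n
      · simpa [h] using hx.1 i h
      · simp only [h, if_false]
        omega
    · obtain h | rfl : i < n ∨ i = n := by omega
      · simpa [h.le, Nat.succ_le_of_lt h] using hx.2 i h
      · simpa using hyv
    · obtain h | rfl : i < n ∨ i = n := by omega
      · simp only [h.le, Nat.succ_le_of_lt h, if_true] at hzi ⊢
        exact hgreedy i h z hz hzi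
      · simp only [le_refl, if_true, show ¬ i + 1 ≤ i by omega, if_false] at hzi ⊢
        exact hmax z ⟨hz, hzi⟩

theorem level_ge_of_not_near (L : IsLevel A ℓ) [Finite V] (hk : 5 ≤ k) (hko : Odd k)
    (hqt : KQuasiTrans A k) {x : ℕ → V} {m : ℕ} (hx : Ascends A ℓ x m) (hm : k + 2 ≤ m)
    (hgreedy : ∀ i < m, ∀ y, ℓ y = i → A y (x (i + 1)) →
      (fullOut A ℓ y).ncard ≤ (fullOut A ℓ (x i)).ncard)
    {i : ℕ} (hi : 1 ≤ i) (him : i < m) {t : V} (ht : ¬ Near A (k + 1) (x i) t) :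
    i + k ≤ ℓ t := by
  by_contra! hlt
  have hge : i + k ≤ ℓ t + 2 := by
    by_contra! h
    exact ht (near_of_level_lt L hk hko hqt hx hm him.le (by omega))
  obtain ⟨y, hy, hyt⟩ := L.exists_ascends t
  have hyi := hy.1 i (by omega)
  have hxi := hx.1 i him.le
  have hsub : fullOut A ℓ (x i) ⊆ fullOut A ℓ (y i) := by
    rintro u ⟨h1, h2, h3⟩
    rw [hxi] at h1 h3
    refine ⟨by omega, (h3 _ hyi).resolve_left fun h4 => ht ?_, by rwa [hyi]⟩
    have h5 := hy.near (i := i) le_rfl (by omega)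
    rw [hyt] at h5
    exact (Near.cons h2 (Near.cons h4 h5)).mono (by omega)
  have hx1 : x (i + 1) ∈ fullOut A ℓ (x i) := by
    refine ⟨by rw [hxi, hx.1 _ (by omega)], hx.2 i him, fun v hv => ?_⟩
    exact adj_pred L hk hko hqt hx hm hx (by omega) (by omega) (by omega)
  have hy1 : y (i + 1) ∈ fullOut A ℓ (y i) := by
    refine ⟨by rw [hyi, hy.1 _ (by omega)], hy.2 i (by omega), fun v hv => ?_⟩
    rw [hyi] at hv
    by_cases hs : k ≤ ℓ t
    · exact adj_pred L hk hko hqt hx hm hy hs (by omega) (by omega)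
    · have hs' : ℓ t + 1 = k := by omega
      have h1 : A t (x k) := by
        refine (adj_pred L hk hko hqt hx hm hx (show k ≤ m by omega) (show k ≤ m by omega)
          hs').resolve_left fun h2 => ht ?_
        exact ((hx.near (i := i) (j := k) (by omega) (by omega)).trans (Near.single h2)).mono
          (by omega)
      have h2 := hy.splice (hx.mono (show k ≤ m by omega)) (by omega) (by rwa [hyt, hs'])
      have h3 := adj_pred L hk hko hqt hx hm h2 le_rfl (j := i + 1) (by omega) (v := v) (by omega)
      simpa [show i + 1 ≤ ℓ t by omega] using h3
  have hy1' : y (i + 1) ∉ fullOut A ℓ (x i) := by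
    rintro ⟨-, h1, -⟩
    have h2 := hy.near (i := i + 1) le_rfl (by omega)
    rw [hyt] at h2
    exact ht ((Near.cons h1 h2).mono (by omega))
  have h1 := Set.ncard_lt_ncard ((Set.ssubset_iff_of_subset hsub).2 ⟨_, hy1, hy1'⟩)
    (Set.toFinite _)
  have h2 := hgreedy i him _ hyi (hsub hx1).2.1
  omega

theorem near_of_ne_top (L : IsLevel A ℓ) (hk : 5 ≤ k) (hko : Odd k)
    (hqt : KQuasiTrans A k) {x : ℕ → V} (hx : Ascends A ℓ x (k + 2)) (hmax : ∀ v, ℓ v ≤ k + 2)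
    {t : V} (ht : ℓ t = k + 1) (htx : t ≠ x (k + 1)) (t' : V) : Near A (k + 1) t t' := by
  have hne : ∀ j ≤ k + 2, x j ≠ t := fun j hj h => by
    have h1 := hx.1 j hj
    rw [h, ht] at h1
    exact htx (by rw [← h, h1])
  obtain h1 | h1 := adj_pred L hk hko hqt hx le_rfl hx (by omega) le_rfl (v := t) (by omega)
  · have h2 : A t (x 3) := by
      refine L.arc_of_adj (by rw [hx.1 3 (by omega)]; omega) (hqt.adj
        ((hx.pathIn_of (i := 3) (j := k + 2) (d := k - 1) (S := {w | w ≠ t}) le_rfl (by omega)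
          fun j _ hj => hne j hj).append h1 (PathIn.single t) (by simp) (by omega))).symm
    obtain ⟨q, hq, hqt'⟩ := L.exists_ascends t'
    by_cases hs : k ≤ ℓ t'
    · have h3 := hq.1 (k - 2) (by omega)
      have h4 : A (x (k + 1)) (q (k - 2)) :=
        arc_drop_three L hk hko hqt hx le_rfl (by omega) (by omega)
      have h5 := hq.near (i := k - 2) le_rfl (by omega)
      rw [hqt'] at h5
      have hmax' := hmax t'
      by_cases hqx : q (k - 2) = x (k - 2)
      · have h6 := hx.near (i := 3) (j := k - 2) (by omega) (by omega)
        rw [← hqx] at h6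
        exact ((Near.cons h2 h6).trans h5).mono (by omega)
      · have hqx' : ∀ j ≤ k + 1, x j ≠ q (k - 2) := fun j hj h => by
          have h7 := hx.1 j (by omega)
          rw [h, h3] at h7
          exact hqx (by rw [← h, h7])
        have hqt2 : t ≠ q (k - 2) := fun h => by
          rw [← h] at h3
          omega
        have h6 : A t (q (k - 2)) := by
          refine L.arc_of_adj (by omega) (hqt.adj ((PathIn.single t).append h2
            ((hx.pathIn_of (i := 3) (j := k + 1) (d := k - 2)
              (S := {w | w ≠ t ∧ w ≠ q (k - 2)}) (by omega) (by omega)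
              fun j _ hj => ⟨hne j (by omega), hqx' j hj⟩).append h4 (PathIn.single _) (by simp)
                rfl) ?_ (by omega)))
          rw [Set.disjoint_singleton_left]
          rintro (⟨h, -⟩ | h)
          · exact h rfl
          · exact hqt2 h
        exact (Near.cons h6 h5).mono (by omega)
    · have h3 : A (x 3) (q 0) := arc_drop_three L hk hko hqt hx le_rfl (by omega)
        (by rw [hq.1 0 (by omega)])
      have h5 := hq.near (i := 0) le_rfl (by omega)
      rw [hqt'] at h5
      exact (Near.cons h2 (Near.cons h3 h5)).mono (by omega)
  · obtain ⟨y, hy, rfl⟩ := L.exists_ascends' ht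
    have h2 := near_of_level_lt L hk hko hqt (hy.splice hx (by omega) h1) le_rfl (i := k + 1)
      (by omega) (t := t') (by have := hmax t'; omega)
    simpa using h2

theorem ncard_near (L : IsLevel A ℓ) [Finite V] (hk : 5 ≤ k) (hko : Odd k)
    (hqt : KQuasiTrans A k) (hlong : ∃ v, k + 2 ≤ ℓ v) :
    k + 2 ≤ {v | ∀ u, Near A (k + 1) v u}.ncard := by
  set K := {v | ∀ u, Near A (k + 1) v u} with hK
  obtain ⟨v₀, hv₀⟩ := hlong
  obtain ⟨v₁, hv₁⟩ := Set.exists_max_image Set.univ ℓ Set.finite_univ ⟨v₀, trivial⟩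
  obtain ⟨m, hm⟩ : ∃ m, ℓ v₁ = m := ⟨_, rfl⟩
  have hmax : ∀ v, ℓ v ≤ m := fun v => hm ▸ hv₁.2 v trivial
  have hkm : k + 2 ≤ m := hv₀.trans (hmax v₀)
  obtain ⟨x, hx, -, hgreedy⟩ := exists_greedy L (fun y => (fullOut A ℓ y).ncard) m hm
  have hcard : ∀ a ≤ m, (x '' Set.Icc a m).ncard = m + 1 - a := fun a ha => by
    rw [Set.InjOn.ncard_image, Set.ncard_eq_toFinset_card', Set.toFinset_Icc, Nat.card_Icc]
    intro i hi j hj hij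
    rw [← hx.1 i hi.2, ← hx.1 j hj.2, hij]
  have hmem : ∀ a v, v ∈ x '' Set.Icc a m → v = x (ℓ v) := by
    rintro a _ ⟨i, hi, rfl⟩
    rw [hx.1 i hi.2]
  have htop : ∀ (y : ℕ → V) (n i : ℕ), Ascends A ℓ y n → k + 2 ≤ n → i ≤ n → m + 3 ≤ i + k →
      y i ∈ K := fun y n i hy hn hi him u =>
    near_of_level_lt L hk hko hqt hy hn hi (by have := hmax u; omega)
  have hge : ∀ i t, 1 ≤ i → i < m → ¬ Near A (k + 1) (x i) t → i + k ≤ ℓ t :=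
    fun i t h1 h2 h3 => level_ge_of_not_near L hk hko hqt hx hkm hgreedy h1 h2 h3
  have hking : ∀ i ≤ m, m + 1 ≤ i + k → x i ∈ K := fun i hi him u => by
    by_contra hu
    by_cases h : i < m
    · have := hge i u (by omega) h hu
      have := hmax u
      omega
    · exact hu (htop x m i hx hkm hi (by omega) u)
  by_cases hcase : ∃ i t, 1 ≤ i ∧ m ≤ i + k + 1 ∧ i < m ∧ ¬ Near A (k + 1) (x i) t ∧
      k + 2 ≤ ℓ t
  · obtain ⟨i, t, hi, him, him', ht, hts⟩ := hcase
    obtain ⟨y, hy, hyt⟩ := L.exists_ascends t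
    have h1 := hge i t hi him' ht
    have h2 := hmax t
    have hne : ∀ j, i ≤ j → j ≤ ℓ t → y j ≠ x j := fun j hj hjt h => ht <| by
      have h3 := hx.near (i := i) (j := j) (by omega) hj
      have h4 := hy.near le_rfl hjt
      rw [hyt, h] at h4
      exact (h3.trans h4).mono (by omega)
    have hy1 := hy.1 (ℓ t - 1) (by omega)
    have hy2 := hy.1 (ℓ t) le_rfl
    have hn1 : y (ℓ t - 1) ∉ x '' Set.Icc (m + 1 - k) m := fun h => by
      have := hmem _ _ h
      rw [hy1] at this
      exact hne _ (by omega) (by omega) this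
    have hn2 : y (ℓ t) ∉ insert (y (ℓ t - 1)) (x '' Set.Icc (m + 1 - k) m) := by
      rintro (h | h)
      · rw [h] at hy2
        omega
      · have := hmem _ _ h
        rw [hy2] at this
        exact hne _ (by omega) le_rfl this
    have hsub : insert (y (ℓ t)) (insert (y (ℓ t - 1)) (x '' Set.Icc (m + 1 - k) m)) ⊆ K := by
      rintro _ (rfl | rfl | ⟨j, hj, rfl⟩)
      · exact htop y _ _ hy hts le_rfl (by omega)
      · exact htop y _ _ hy hts (by omega) (by omega)
      · have := hj.1
        exact hking j hj.2 (by omega)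
    have h3 := Set.ncard_le_ncard hsub (Set.toFinite _)
    rw [Set.ncard_insert_of_notMem hn2 (Set.toFinite _),
      Set.ncard_insert_of_notMem hn1 (Set.toFinite _), hcard _ (by omega)] at h3
    omega
  push Not at hcase
  have hk1 : x (m - k) ∈ K := fun t => by
    by_contra ht
    have h1 := hge _ t (by omega) (by omega) ht
    have h2 := hcase _ t (by omega) (by omega) (by omega) ht
    omega
  have hking' : ∀ i ≤ m, m ≤ i + k → x i ∈ K := fun i hi him => by
    obtain rfl | h : i = m - k ∨ m + 1 ≤ i + k := by omega
    · exact hk1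
    · exact hking i hi h
  by_cases hk2 : x (m - k - 1) ∈ K
  · have hsub : x '' Set.Icc (m - k - 1) m ⊆ K := by
      rintro _ ⟨j, hj, rfl⟩
      have := hj.1
      obtain rfl | h : j = m - k - 1 ∨ m ≤ j + k := by omega
      · exact hk2
      · exact hking' j hj.2 h
    have h3 := Set.ncard_le_ncard hsub (Set.toFinite _)
    rw [hcard _ (by omega)] at h3
    omega
  · change ¬ ∀ u, Near A (k + 1) (x (m - k - 1)) u at hk2
    push Not at hk2
    obtain ⟨t, ht⟩ := hk2
    have h1 := hge _ t (by omega) (by omega) ht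
    have h2 := hcase _ t (by omega) (by omega) (by omega) ht
    obtain rfl : m = k + 2 := by omega
    have hts : ℓ t = k + 1 := by omega
    have htx : t ≠ x (k + 1) := by
      rintro rfl
      exact ht ((hx.near (by omega) (by omega)).mono (by omega))
    have htK : t ∈ K := near_of_ne_top L hk hko hqt hx hmax hts htx
    have hn1 : t ∉ x '' Set.Icc 2 (k + 2) := fun h => htx (by
      have := hmem _ _ h
      rwa [hts] at this)
    have hsub : insert t (x '' Set.Icc 2 (k + 2)) ⊆ K := by
      rintro _ (rfl | ⟨j, hj, rfl⟩)
      · exact htK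
      · have := hj.1
        exact hking' j hj.2 (by omega)
    have h3 := Set.ncard_le_ncard hsub (Set.toFinite _)
    rw [Set.ncard_insert_of_notMem hn1 (Set.toFinite _), hcard _ (by omega)] at h3
    omega

end IsLevel

end Levels

theorem Near.exists_pred {A : V → V → Prop} {r : ℕ} {u v : V} (h : Near A (r + 1) u v) :
    Near A r u v ∨ ∃ z, Near A r u z ∧ A z v := by
  induction r generalizing u with
  | zero =>
    obtain rfl | ⟨z, hz, rfl⟩ := h
    · exact Or.inl rfl
    · exact Or.inr ⟨u, rfl, hz⟩
  | succ r ih =>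
    obtain rfl | ⟨z, hz, h⟩ := h
    · exact Or.inl (Near.refl _ _)
    · obtain h | ⟨y, hy, hyv⟩ := ih h
      · exact Or.inl (Near.cons hz h)
      · exact Or.inr ⟨y, Near.cons hz hy, hyv⟩

/-- The distance from a vertex reaching all others is a level function. -/
theorem exists_isLevel {A : V → V → Prop} {w : V} (hw : ∀ v, Reaches A w v) :
    ∃ ℓ : V → ℕ, IsLevel A ℓ ∧ ℓ w = 0 ∧ ∀ r v, Near A r w v ↔ ℓ v ≤ r := by
  classical
  have hex : ∀ v, ∃ r, Near A r w v := fun v => by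
    obtain ⟨r, hr⟩ := hw v
    exact ⟨r, hr.near⟩
  have hiff : ∀ r v, Near A r w v ↔ Nat.find (hex v) ≤ r := fun r v =>
    ⟨fun h => Nat.find_min' _ h, fun h => (Nat.find_spec (hex v)).mono h⟩
  obtain ⟨ℓ, hiff⟩ : ∃ ℓ : V → ℕ, ∀ r v, Near A r w v ↔ ℓ v ≤ r := ⟨_, hiff⟩
  have hself : ∀ v, Near A (ℓ v) w v := fun v => (hiff _ _).2 le_rfl
  have hstep : ∀ u v, A u v → ℓ v ≤ ℓ u + 1 := fun u v huv =>
    (hiff _ _).1 ((hself u).trans (Near.single huv))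
  have hroot : ∀ v, ℓ v = 0 → w = v := fun v hv => (hiff 0 v).2 hv.le
  refine ⟨ℓ, ⟨hstep, fun u v hu hv => (hroot u hu).symm.trans (hroot v hv), fun v => ?_⟩,
    Nat.le_zero.1 ((hiff 0 w).1 rfl), hiff⟩
  obtain ⟨n, hn⟩ : ∃ n, ℓ v = n := ⟨_, rfl⟩
  rw [hn]
  induction n generalizing v with
  | zero => exact ⟨fun _ => v, ⟨fun i hi => by rw [hn, Nat.le_zero.1 hi], by simp⟩, rfl⟩
  | succ n ih =>
    obtain h | ⟨z, hz, hzv⟩ := ((hiff _ _).2 hn.le).exists_pred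
    · have := (hiff _ _).1 h
      omega
    · have h1 := (hiff _ _).1 hz
      have h2 := hstep _ _ hzv
      obtain ⟨x, hx, rfl⟩ := ih z (by omega)
      refine ⟨fun i => if i ≤ n then x i else v, ⟨fun i hi => ?_, fun i hi => ?_⟩, by simp⟩
      · by_cases h : i ≤ n
        · simpa [h] using hx.1 i h
        · simp only [h, if_false]
          omega
      · obtain h | rfl : i < n ∨ i = n := by omega
        · simpa [h.le, Nat.succ_le_of_lt h] using hx.2 i h
        · simpa using hzv

theorem IsInitialStrongComponent.mem_of_reflTransGen {A : V → V → Prop} {C : Set V}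
    (hC : IsInitialStrongComponent A C) {u v : V} (h : Relation.ReflTransGen A u v) (hv : v ∈ C) :
    u ∈ C := by
  induction h using Relation.ReflTransGen.head_induction_on with
  | refl => exact hv
  | head huz _ ih => exact by_contra fun hu => hC.2 _ _ hu ih huz

/-- If the initial strong component is unique, then its vertices reach every vertex. -/
theorem reaches_of_mem_initial [Finite V] {A : V → V → Prop} {C : Set V}
    (hC : IsInitialStrongComponent A C) (huniq : ∀ S, IsInitialStrongComponent A S → S = C)
    {v : V} (hv : v ∈ C) (u : V) : Reaches A v u := by
  obtain ⟨z, hzu, hmin⟩ := Set.exists_min_image {z | Relation.ReflTransGen A z u}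
    (fun z => {y | Relation.ReflTransGen A y z}.ncard) (Set.toFinite _)
    ⟨u, Relation.ReflTransGen.refl⟩
  have hback : ∀ y, Relation.ReflTransGen A y z → Relation.ReflTransGen A z y := fun y hyz => by
    have h1 := Set.eq_of_subset_of_ncard_le
      (fun a (ha : Relation.ReflTransGen A a y) => ha.trans hyz) (hmin y (hyz.trans hzu))
      (Set.toFinite _)
    exact h1.symm.subset (Relation.ReflTransGen.refl : Relation.ReflTransGen A z z)
  have hz : z ∈ C := by
    rw [← huniq {y | Reaches A y z ∧ Reaches A z y} ⟨⟨z, rfl⟩, fun a b ha hb hab => ha ?_⟩]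
    · exact ⟨reaches_iff.2 .refl, reaches_iff.2 .refl⟩
    · have h1 := (reaches_iff.1 hb.1).head hab
      exact ⟨reaches_iff.2 h1, reaches_iff.2 (hback _ h1)⟩
  obtain ⟨c, rfl⟩ := hC.1
  exact reaches_iff.2 (((reaches_iff.1 hv.1).trans (reaches_iff.1 hz.2)).trans hzu)

theorem ncard_le_of_ascends [Finite V] {A : V → V → Prop} {C : Set V}
    (hC : IsInitialStrongComponent A C) {ℓ : V → ℕ} {x : ℕ → V} {n : ℕ} (hx : Ascends A ℓ x n)
    (h : x n ∈ C) : n + 1 ≤ C.ncard := by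
  have hsub : x '' Set.Icc 0 n ⊆ C := by
    rintro _ ⟨i, hi, rfl⟩
    exact hC.mem_of_reflTransGen (hx.near le_rfl hi.2).reflTransGen h
  have h1 := Set.ncard_le_ncard hsub (Set.toFinite _)
  rw [Set.InjOn.ncard_image, Set.ncard_eq_toFinset_card', Set.toFinset_Icc, Nat.card_Icc] at h1
  · exact h1
  · intro i hi j hj hij
    rw [← hx.1 i hi.2, ← hx.1 j hj.2, hij]

theorem setOf_isRKing_eq {A : V → V → Prop} {C : Set V} (hC : IsInitialStrongComponent A C)
    {r : ℕ} (h : ∀ v ∈ C, ∀ u, Near A r v u) : {v | IsRKing A r v} = C := by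
  refine Set.Subset.antisymm (fun v hv => ?_) fun v hv => isRKing_iff.2 (h v hv)
  obtain ⟨c, hc⟩ := hC.1
  refine hC.mem_of_reflTransGen (isRKing_iff.1 hv c).reflTransGen ?_
  rw [hc]
  exact ⟨reaches_iff.2 .refl, reaches_iff.2 .refl⟩

theorem near_of_ncard_le [Finite V] {A : V → V → Prop} {k : ℕ} (hk : 5 ≤ k)
    (hqt : KQuasiTrans A k) {C : Set V} (hC : IsInitialStrongComponent A C)
    (huniq : ∀ S, IsInitialStrongComponent A S → S = C) {e : ℕ} (he : e ≤ 1)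
    (hn : C.ncard ≤ k + e) {v : V} (hv : v ∈ C) (u : V) : Near A (k + e - 1) v u := by
  obtain ⟨ℓ, L, hℓ, hiff⟩ := exists_isLevel (reaches_of_mem_initial hC huniq hv)
  rw [hiff]
  by_contra! hlt
  obtain ⟨x, hx, -⟩ := L.exists_ascends u
  have hx0 : x 0 = v := L.root _ _ (hx.1 0 (by omega)) hℓ
  have h0 : x 0 ∈ C := hx0 ▸ hv
  have hxk : x k ∈ C := by
    have := L.arc_drop_k hk hqt (hx.mono (m := k) (by omega)) (b := 0) (by omega)
    rw [zero_add] at this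
    exact hC.mem_of_reflTransGen (.single this) h0
  have hxe : x (e + k) ∈ C := by
    refine hC.mem_of_reflTransGen ?_ hxk
    exact (Relation.ReflTransGen.single (L.arc_drop_k hk hqt hx (b := e) (by omega))).trans
      (hx.near (by omega) (by omega)).reflTransGen
  have := ncard_le_of_ascends hC (hx.mono (m := e + k) (by omega)) hxe
  omega

/-- odd `k ≥ 5`, unique initial strong component `C` with `n` vertices.
(1) if `n ≤ k`, exactly `n` `(k−1)`-kings; (2) if `n = k+1`, exactly `k+1` `k`-kings;
(3) if `n ≥ k+2`, at least `k+2` `(k+1)`-kings. -/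
theorem kqt_odd_number_of_kings
    [Fintype V] (A : V → V → Prop) (hloop : ∀ v : V, ¬ A v v)
    (k : ℕ) (hk : 5 ≤ k) (hko : Odd k) (hqt : KQuasiTrans A k)
    (C : Set V) (hC : IsInitialStrongComponent A C)
    (huniq : ∀ S : Set V, IsInitialStrongComponent A S → S = C)
    (n : ℕ) (hn : C.ncard = n) :
    (n ≤ k → {v : V | IsRKing A (k - 1) v}.ncard = n) ∧
    (n = k + 1 → {v : V | IsRKing A k v}.ncard = k + 1) ∧
    (k + 2 ≤ n → k + 2 ≤ {v : V | IsRKing A (k + 1) v}.ncard) := by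
  refine ⟨fun h => ?_, fun h => ?_, fun h => ?_⟩
  · rw [setOf_isRKing_eq hC (r := k - 1) fun v hv u =>
      near_of_ncard_le hk hqt hC huniq (e := 0) (by omega) (by omega) hv u, hn]
  · rw [setOf_isRKing_eq hC (r := k) fun v hv u =>
      near_of_ncard_le hk hqt hC huniq (e := 1) (by omega) (by omega) hv u, hn, h]
  · by_cases hall : ∀ v ∈ C, ∀ u, Near A (k + 1) v u
    · rw [setOf_isRKing_eq hC hall, hn]
      exact h
    · push Not at hall
      obtain ⟨w, hw, u, hu⟩ := hall
      obtain ⟨ℓ, L, -, hiff⟩ := exists_isLevel (reaches_of_mem_initial hC huniq hw)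
      rw [hiff] at hu
      simp only [isRKing_iff]
      exact L.ncard_near hk hko hqt ⟨u, by omega⟩
end
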